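/- arXiv:0910.2096 — 2 statements merged into one kernel-verified Lean document; each statement's English description precedes it below -/
import Mathlib

section
/- Let P, R : ℂ → M₂(ℂ) be smooth 2×2-matrix valued functions and H a nonzero real constant such that the Maurer–Cartan equation ∂R − ∂̄P + [P,R] = 0 and the constant mean curvature equation i(∂̄P + ∂R) = H[P,R] hold identically (here [X,Y] = XY − YX). For λ ∈ ℂ\{0} define A_λ = (1/2)(1 − λ⁻¹)(1 + iH) P and B_λ = (1/2)(1 − λ)(1 − iH) R. Then the zero-curvature equation ∂B_λ − ∂̄A_λ + [A_λ, B_λ] = 0 holds identically on ℂ for every λ ∈ ℂ\{0}. -/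
noncomputable section

open Complex Matrix

/-- Wirtinger derivative `∂f = (1/2)(f_x - i f_y)`. -/
def wd (f : ℂ → ℂ) (z : ℂ) : ℂ :=
  (fderiv ℝ f z 1 - Complex.I * fderiv ℝ f z Complex.I) / 2

/-- Conjugate Wirtinger derivative `∂̄f = (1/2)(f_x + i f_y)`. -/
def wdb (f : ℂ → ℂ) (z : ℂ) : ℂ :=
  (fderiv ℝ f z 1 + Complex.I * fderiv ℝ f z Complex.I) / 2

/-- Complexification of a real-valued function. -/
def cx (u : ℂ → ℝ) : ℂ → ℂ := fun z => (u z : ℂ)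

/-- Entrywise Wirtinger derivative of a matrix-valued function. -/
def mwd (F : ℂ → Matrix (Fin 2) (Fin 2) ℂ) (z : ℂ) : Matrix (Fin 2) (Fin 2) ℂ :=
  Matrix.of fun i j => wd (fun w => F w i j) z

/-- Entrywise conjugate Wirtinger derivative of a matrix-valued function. -/
def mwdb (F : ℂ → Matrix (Fin 2) (Fin 2) ℂ) (z : ℂ) : Matrix (Fin 2) (Fin 2) ℂ :=
  Matrix.of fun i j => wdb (fun w => F w i j) z

/-- Entrywise Wirtinger derivative of a vector-valued function. -/
def vwd (v : ℂ → Fin 2 → ℂ) (z : ℂ) : Fin 2 → ℂ := fun i => wd (fun w => v w i) z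

/-- Entrywise conjugate Wirtinger derivative of a vector-valued function. -/
def vwdb (v : ℂ → Fin 2 → ℂ) (z : ℂ) : Fin 2 → ℂ := fun i => wdb (fun w => v w i) z

/-- `u` solves the sinh-Gordon equation `∂∂̄u + (1/2) sinh (2u) = 0`. -/
def SinhGordon (u : ℂ → ℝ) : Prop :=
  ∀ z, wd (wdb (cx u)) z + (1/2) * Complex.sinh (2 * (u z : ℂ)) = 0

/-- `(ψ₁, ψ₂)` solves the system `(Ψ_λ)`. -/
def SolPsi (u : ℂ → ℝ) (lam : ℂ) (p1 p2 : ℂ → ℂ) : Prop :=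
  ContDiff ℝ (⊤ : ℕ∞) p1 ∧ ContDiff ℝ (⊤ : ℕ∞) p2 ∧
  (∀ z, wd p1 z = (1/2) * (wd (cx u) z * p1 z
      + Complex.I * Complex.exp (-(u z : ℂ)) * p2 z)) ∧
  (∀ z, wd p2 z = (1/2) * (Complex.I * lam⁻¹ * Complex.exp ((u z : ℂ)) * p1 z
      - wd (cx u) z * p2 z)) ∧
  (∀ z, wdb p1 z = (1/2) * (-(wdb (cx u) z) * p1 z
      + Complex.I * lam * Complex.exp ((u z : ℂ)) * p2 z)) ∧
  (∀ z, wdb p2 z = (1/2) * (Complex.I * Complex.exp (-(u z : ℂ)) * p1 z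
      + wdb (cx u) z * p2 z))

/-- `(φ₁, φ₂)` solves the system `(Φ_λ)`. -/
def SolPhi (u : ℂ → ℝ) (lam : ℂ) (f1 f2 : ℂ → ℂ) : Prop :=
  ContDiff ℝ (⊤ : ℕ∞) f1 ∧ ContDiff ℝ (⊤ : ℕ∞) f2 ∧
  (∀ z, wd f1 z = -(1/2) * (wd (cx u) z * f1 z
      + Complex.I * lam⁻¹ * Complex.exp ((u z : ℂ)) * f2 z)) ∧
  (∀ z, wd f2 z = -(1/2) * (Complex.I * Complex.exp (-(u z : ℂ)) * f1 z
      - wd (cx u) z * f2 z)) ∧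
  (∀ z, wdb f1 z = -(1/2) * (-(wdb (cx u) z) * f1 z
      + Complex.I * Complex.exp (-(u z : ℂ)) * f2 z)) ∧
  (∀ z, wdb f2 z = -(1/2) * (Complex.I * lam * Complex.exp ((u z : ℂ)) * f1 z
      + wdb (cx u) z * f2 z))

/-- The matrix `A_λ = (1/2) [[∂u, iλ⁻¹e^u], [ie^{-u}, -∂u]]`. -/
def matA (u : ℂ → ℝ) (lam : ℂ) (z : ℂ) : Matrix (Fin 2) (Fin 2) ℂ :=
  ((1:ℂ)/2) • !![wd (cx u) z, Complex.I * lam⁻¹ * Complex.exp ((u z : ℂ));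
    Complex.I * Complex.exp (-(u z : ℂ)), -(wd (cx u) z)]

/-- The matrix `B_λ = (1/2) [[-∂̄u, ie^{-u}], [iλe^u, ∂̄u]]`. -/
def matB (u : ℂ → ℝ) (lam : ℂ) (z : ℂ) : Matrix (Fin 2) (Fin 2) ℂ :=
  ((1:ℂ)/2) • !![-(wdb (cx u) z), Complex.I * Complex.exp (-(u z : ℂ));
    Complex.I * lam * Complex.exp ((u z : ℂ)), wdb (cx u) z]

theorem wd_const_mul {f : ℂ → ℂ} {z : ℂ} (hf : DifferentiableAt ℝ f z) (c : ℂ) :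
    wd (fun w => c * f w) z = c * wd f z := by
  simp only [wd, fderiv_const_mul hf c, _root_.smul_apply, smul_eq_mul]
  ring

theorem wdb_const_mul {f : ℂ → ℂ} {z : ℂ} (hf : DifferentiableAt ℝ f z) (c : ℂ) :
    wdb (fun w => c * f w) z = c * wdb f z := by
  simp only [wdb, fderiv_const_mul hf c, _root_.smul_apply, smul_eq_mul]
  ring

theorem mwd_const_smul {F : ℂ → Matrix (Fin 2) (Fin 2) ℂ} {z : ℂ}
    (hF : ∀ i j, DifferentiableAt ℝ (fun w => F w i j) z) (c : ℂ) :
    mwd (fun w => c • F w) z = c • mwd F z := by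
  ext i j
  exact wd_const_mul (hF i j) c

theorem mwdb_const_smul {F : ℂ → Matrix (Fin 2) (Fin 2) ℂ} {z : ℂ}
    (hF : ∀ i j, DifferentiableAt ℝ (fun w => F w i j) z) (c : ℂ) :
    mwdb (fun w => c • F w) z = c • mwdb F z := by
  ext i j
  exact wdb_const_mul (hF i j) c

/-- the associated family of flat connections of a CMC immersion. -/
theorem statement1 (P R : ℂ → Matrix (Fin 2) (Fin 2) ℂ)
    (hP : ∀ i j, ContDiff ℝ (⊤ : ℕ∞) fun z => P z i j)
    (hR : ∀ i j, ContDiff ℝ (⊤ : ℕ∞) fun z => R z i j)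
    (H : ℝ) (hH : H ≠ 0)
    (hMC : ∀ z, mwd R z - mwdb P z + (P z * R z - R z * P z) = 0)
    (hCMC : ∀ z, Complex.I • (mwdb P z + mwd R z) = (H : ℂ) • (P z * R z - R z * P z)) :
    ∀ lam : ℂ, lam ≠ 0 → ∀ z : ℂ,
      mwd (fun w => (((1:ℂ)/2) * (1 - lam) * (1 - Complex.I * (H : ℂ))) • R w) z
      - mwdb (fun w => (((1:ℂ)/2) * (1 - lam⁻¹) * (1 + Complex.I * (H : ℂ))) • P w) z
      + ((((1:ℂ)/2) * (1 - lam⁻¹) * (1 + Complex.I * (H : ℂ))) • P z)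
          * ((((1:ℂ)/2) * (1 - lam) * (1 - Complex.I * (H : ℂ))) • R z)
      - ((((1:ℂ)/2) * (1 - lam) * (1 - Complex.I * (H : ℂ))) • R z)
          * ((((1:ℂ)/2) * (1 - lam⁻¹) * (1 + Complex.I * (H : ℂ))) • P z) = 0 := by
  intro lam hlam z
  have differentiable_entry {F : ℂ → Matrix (Fin 2) (Fin 2) ℂ}
      (hF : ∀ i j, ContDiff ℝ (⊤ : ℕ∞) fun z => F z i j) (i j) :
      DifferentiableAt ℝ (fun w => F w i j) z :=
    (hF i j).differentiable (by simp) z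
  rw [mwd_const_smul (differentiable_entry hR), mwdb_const_smul (differentiable_entry hP)]
  have hMCz := hMC z
  have hCMCz := hCMC z
  ext i j
  replace hMCz := congrFun (congrFun hMCz i) j
  replace hCMCz := congrFun (congrFun hCMCz i) j
  simp only [smul_mul_smul_comm, Matrix.add_apply, Matrix.sub_apply, Matrix.smul_apply,
    Matrix.zero_apply, smul_eq_mul] at hMCz hCMCz ⊢
  generalize mwd R z i j = r at *
  generalize mwdb P z i j = p at *
  generalize (P z * R z) i j = x at *
  generalize (R z * P z) i j = y at *
  have hr : r = -(1 + I * H) / 2 * (x - y) := by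
    linear_combination hMCz / 2 - I / 2 * hCMCz + (p + r) / 2 * I_sq
  have hp : p = (1 - I * H) / 2 * (x - y) := by
    linear_combination -hMCz / 2 - I / 2 * hCMCz + (p + r) / 2 * I_sq
  rw [hr, hp]
  field_simp
  ring
end
end

section
/- Let u : ℂ → ℝ be smooth, λ ∈ ℂ\{0}, let (ψ₁, ψ₂) solve system (Ψ_λ) and (φ₁, φ₂) solve system (Φ_λ), and set ω = ψ₁φ₁ − ψ₂φ₂. Then ∂ω = i e^{−u} ψ₂φ₁ − i λ⁻¹ e^{u} ψ₁φ₂, the homogeneous Jacobi equation ∂̄∂ω + cosh(2u) ω = 0 holds identically, and moreover ∂̄(i e^{−u} ψ₂φ₁ + i λ⁻¹ e^{u} ψ₁φ₂) = ω sinh(2u). -/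
noncomputable section

open Complex Matrix

section Wirtinger

variable {f g : ℂ → ℂ} {z : ℂ}

theorem wd_sub (hf : DifferentiableAt ℝ f z) (hg : DifferentiableAt ℝ g z) :
    wd (fun w => f w - g w) z = wd f z - wd g z := by
  simp only [wd, fderiv_fun_sub hf hg, _root_.sub_apply]
  ring

theorem wd_mul (hf : DifferentiableAt ℝ f z) (hg : DifferentiableAt ℝ g z) :
    wd (fun w => f w * g w) z = wd f z * g z + f z * wd g z := by
  simp only [wd, fderiv_fun_mul hf hg, _root_.add_apply,
    _root_.smul_apply, smul_eq_mul]
  ring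

theorem wdb_add (hf : DifferentiableAt ℝ f z) (hg : DifferentiableAt ℝ g z) :
    wdb (fun w => f w + g w) z = wdb f z + wdb g z := by
  simp only [wdb, fderiv_fun_add hf hg, _root_.add_apply]
  ring

theorem wdb_sub (hf : DifferentiableAt ℝ f z) (hg : DifferentiableAt ℝ g z) :
    wdb (fun w => f w - g w) z = wdb f z - wdb g z := by
  simp only [wdb, fderiv_fun_sub hf hg, _root_.sub_apply]
  ring

theorem wdb_mul (hf : DifferentiableAt ℝ f z) (hg : DifferentiableAt ℝ g z) :
    wdb (fun w => f w * g w) z = wdb f z * g z + f z * wdb g z := by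
  simp only [wdb, fderiv_fun_mul hf hg, _root_.add_apply,
    _root_.smul_apply, smul_eq_mul]
  ring

theorem wdb_const (c : ℂ) : wdb (fun _ => c) z = 0 := by
  simp [wdb]

theorem wdb_neg : wdb (fun w => -f w) z = -wdb f z := by
  simp only [wdb, fderiv_fun_neg, _root_.neg_apply]
  ring

theorem wdb_cexp (hf : DifferentiableAt ℝ f z) :
    wdb (fun w => Complex.exp (f w)) z = Complex.exp (f z) * wdb f z := by
  simp only [wdb, hf.hasFDerivAt.cexp.fderiv, _root_.smul_apply, smul_eq_mul]
  ring

end Wirtinger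

/-- `ω = ψ₁φ₁ - ψ₂φ₂` lies in the kernel of the Jacobi operator. -/
theorem statement8 (u : ℂ → ℝ) (hu : ContDiff ℝ (⊤ : ℕ∞) u) (lam : ℂ) (hlam : lam ≠ 0)
    (p1 p2 f1 f2 : ℂ → ℂ) (hpsi : SolPsi u lam p1 p2) (hphi : SolPhi u lam f1 f2) :
    (∀ z, wd (fun w => p1 w * f1 w - p2 w * f2 w) z
        = Complex.I * Complex.exp (-(u z : ℂ)) * p2 z * f1 z
          - Complex.I * lam⁻¹ * Complex.exp ((u z : ℂ)) * p1 z * f2 z) ∧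
    (∀ z, wdb (wd (fun w => p1 w * f1 w - p2 w * f2 w)) z
        + Complex.cosh (2 * (u z : ℂ)) * (p1 z * f1 z - p2 z * f2 z) = 0) ∧
    (∀ z, wdb (fun w => Complex.I * Complex.exp (-(u w : ℂ)) * p2 w * f1 w
          + Complex.I * lam⁻¹ * Complex.exp ((u w : ℂ)) * p1 w * f2 w) z
        = (p1 z * f1 z - p2 z * f2 z) * Complex.sinh (2 * (u z : ℂ))) := by
  obtain ⟨hp1, hp2, dp1, dp2, bp1, bp2⟩ := hpsi
  obtain ⟨hf1, hf2, df1, df2, bf1, bf2⟩ := hphi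
  have diff {g : ℂ → ℂ} (hg : ContDiff ℝ (⊤ : ℕ∞) g) : Differentiable ℝ g :=
    hg.differentiable (by simp)
  replace hp1 := diff hp1
  replace hp2 := diff hp2
  replace hf1 := diff hf1
  replace hf2 := diff hf2
  have hcx : Differentiable ℝ (fun w => (u w : ℂ)) :=
    diff (Complex.ofRealCLM.contDiff.comp hu)
  have cx_eq : cx u = fun w => (u w : ℂ) := rfl
  have hexp : Differentiable ℝ (fun w => Complex.exp (u w : ℂ)) := hcx.cexp
  have hexpn : Differentiable ℝ (fun w => Complex.exp (-(u w : ℂ))) := hcx.neg.cexp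
  have hd (z : ℂ) : wd (fun w => p1 w * f1 w - p2 w * f2 w) z
      = Complex.I * Complex.exp (-(u z : ℂ)) * p2 z * f1 z
        - Complex.I * lam⁻¹ * Complex.exp ((u z : ℂ)) * p1 z * f2 z := by
    rw [wd_sub ((hp1 z).fun_mul (hf1 z)) ((hp2 z).fun_mul (hf2 z)), wd_mul (hp1 z) (hf1 z),
      wd_mul (hp2 z) (hf2 z), dp1, dp2, df1, df2]
    ring
  have hA : Differentiable ℝ
      (fun w => Complex.I * Complex.exp (-(u w : ℂ)) * p2 w * f1 w) := by fun_prop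
  have hB : Differentiable ℝ
      (fun w => Complex.I * lam⁻¹ * Complex.exp (u w : ℂ) * p1 w * f2 w) := by fun_prop
  have hbA (z : ℂ) : wdb (fun w => Complex.I * Complex.exp (-(u w : ℂ)) * p2 w * f1 w) z
      = -(1/2) * Complex.exp (-(u z : ℂ)) ^ 2 * (p1 z * f1 z - p2 z * f2 z) := by
    rw [wdb_mul (by fun_prop) (hf1 z), wdb_mul ((hexpn z).const_mul _) (hp2 z),
      wdb_mul (by fun_prop) (hexpn z), wdb_const, wdb_cexp (hcx z).fun_neg, wdb_neg, bp2, bf1, cx_eq]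
    linear_combination (1/2) * Complex.exp (-(u z : ℂ)) ^ 2 * (p1 z * f1 z - p2 z * f2 z) * I_sq
  have hbB (z : ℂ) :
      wdb (fun w => Complex.I * lam⁻¹ * Complex.exp (u w : ℂ) * p1 w * f2 w) z
      = (1/2) * Complex.exp (u z : ℂ) ^ 2 * (p1 z * f1 z - p2 z * f2 z) := by
    rw [wdb_mul (by fun_prop) (hf2 z), wdb_mul ((hexp z).const_mul _) (hp1 z),
      wdb_mul (by fun_prop) (hexp z), wdb_const, wdb_cexp (hcx z), bp1, bf2, cx_eq]
    field_simp
    linear_combination -Complex.exp (u z : ℂ) * lam * (p1 z * f1 z - p2 z * f2 z) * I_sq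
  refine ⟨hd, fun z => ?_, fun z => ?_⟩
  · rw [funext hd, wdb_sub (hA z) (hB z), hbA, hbB, Complex.cosh, ← mul_neg, two_mul, two_mul,
      Complex.exp_add, Complex.exp_add]
    ring
  · rw [wdb_add (hA z) (hB z), hbA, hbB, Complex.sinh, ← mul_neg, two_mul, two_mul,
      Complex.exp_add, Complex.exp_add]
    ring
end
end
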